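/- For Re(z) > 0, the Hurwitz zeta function satisfies the Euler–MacLaurin formula ζ(s,z) = z^{1-s}/(s-1) + z^{-s}/2 + (s/12) z^{-s-1} - (s(s+1)/2) ∫_0^∞ B̄_2(t)/(z+t)^{s+2} dt, valid for all s ≠ 1 with Re(s) > -1. -/

import Mathlib

open Complex MeasureTheory

/-- Translating a point of the right half-plane by a nonnegative real stays in the slit plane. -/
lemma add_ofReal_mem_slitPlane {z : ℂ} (hz : 0 < z.re) {t : ℝ} (ht : 0 ≤ t) :
    z + t ∈ slitPlane := by
  refine Or.inl ?_
  simp only [add_re, ofReal_re]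
  linarith

lemma re_add_le_norm_add_ofReal (z : ℂ) (t : ℝ) : t + z.re ≤ ‖z + t‖ := by
  have := re_le_norm (z + t)
  simp only [add_re, ofReal_re] at this
  linarith

lemma norm_cpow_le_rpow_mul_exp {w : ℂ} (hw : w ≠ 0) (a : ℂ) :
    ‖w ^ a‖ ≤ ‖w‖ ^ a.re * Real.exp (Real.pi * |a.im|) := by
  rw [norm_cpow_of_ne_zero hw, div_eq_mul_inv, ← Real.exp_neg]
  gcongr
  calc -(arg w * a.im) ≤ |arg w * a.im| := neg_le_abs _
    _ = |arg w| * |a.im| := abs_mul _ _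
    _ ≤ Real.pi * |a.im| := by
      gcongr
      exact abs_arg_le_pi w

lemma norm_add_ofReal_cpow_le {z : ℂ} (hz : 0 < z.re) {t : ℝ} (ht : 0 ≤ t) {a : ℂ}
    (ha : a.re ≤ 0) :
    ‖(z + t) ^ a‖ ≤ (t + z.re) ^ a.re * Real.exp (Real.pi * |a.im|) := by
  refine (norm_cpow_le_rpow_mul_exp (slitPlane_ne_zero (add_ofReal_mem_slitPlane hz ht)) a).trans ?_
  gcongr ?_ * _
  exact Real.rpow_le_rpow_of_nonpos (by linarith) (re_add_le_norm_add_ofReal z t) ha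

lemma rpow_le_rpow_add_rpow_of_le_of_le {y b e B : ℝ} (hy : 0 < y) (hb : b ≤ e) (hB : e ≤ B) :
    y ^ e ≤ y ^ b + y ^ B := by
  rcases le_total y 1 with h | h
  · have := Real.rpow_le_rpow_of_exponent_ge hy h hb
    have := Real.rpow_nonneg hy.le B
    linarith
  · have := Real.rpow_le_rpow_of_exponent_le h hB
    have := Real.rpow_nonneg hy.le b
    linarith

lemma norm_log_le_rpow {w : ℂ} (hw : w ≠ 0) {ε : ℝ} (hε : 0 < ε) :
    ‖log w‖ ≤ ‖w‖ ^ ε / ε + ‖w‖ ^ (-ε) / ε + Real.pi := by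
  have hw' : 0 < ‖w‖ := norm_pos_iff.mpr hw
  have h1 : ‖log w‖ ≤ |Real.log ‖w‖| + |arg w| := by
    simpa [log_re, log_im] using norm_le_abs_re_add_abs_im (log w)
  have h2 := Real.log_le_rpow_div hw'.le hε
  have h3 := Real.log_le_rpow_div (inv_pos.mpr hw').le hε
  rw [Real.log_inv, Real.inv_rpow hw'.le, ← Real.rpow_neg hw'.le] at h3
  have h4 : 0 ≤ ‖w‖ ^ ε / ε := by positivity
  have h5 : 0 ≤ ‖w‖ ^ (-ε) / ε := by positivity
  have h6 : |Real.log ‖w‖| ≤ ‖w‖ ^ ε / ε + ‖w‖ ^ (-ε) / ε := abs_le.mpr ⟨by linarith, by linarith⟩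
  linarith [abs_arg_le_pi w]

/-- The derivative of `a ↦ (z + t) ^ a`, bounded uniformly on a vertical strip. -/
lemma norm_cpow_mul_log_le {z : ℂ} (hz : 0 < z.re) {t : ℝ} (ht : 0 ≤ t) {a : ℂ} {b B M ε : ℝ}
    (hε : 0 < ε) (hb : b ≤ a.re - ε) (hB : a.re + ε ≤ B) (hB0 : B ≤ 0) (hM : |a.im| ≤ M) :
    ‖(z + t) ^ a * log (z + t)‖ ≤
      (2 / ε + Real.pi) * Real.exp (Real.pi * M) * ((t + z.re) ^ b + (t + z.re) ^ B) := by
  have hw := slitPlane_ne_zero (add_ofReal_mem_slitPlane hz ht)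
  have hy : 0 < t + z.re := by linarith
  have hwy := re_add_le_norm_add_ofReal z t
  set w : ℂ := z + t
  set y : ℝ := t + z.re
  have hw0 : 0 < ‖w‖ := norm_pos_iff.mpr hw
  have key : ∀ e : ℝ, b ≤ e → e ≤ B → ‖w‖ ^ e ≤ y ^ b + y ^ B := fun e h1 h2 =>
    (Real.rpow_le_rpow_of_nonpos hy hwy (h2.trans hB0)).trans
      (rpow_le_rpow_add_rpow_of_le_of_le hy h1 h2)
  have h1 : ‖w ^ a‖ ≤ ‖w‖ ^ a.re * Real.exp (Real.pi * M) := by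
    refine (norm_cpow_le_rpow_mul_exp hw a).trans ?_
    gcongr
  calc ‖w ^ a * log w‖ = ‖w ^ a‖ * ‖log w‖ := norm_mul _ _
    _ ≤ (‖w‖ ^ a.re * Real.exp (Real.pi * M)) * (‖w‖ ^ ε / ε + ‖w‖ ^ (-ε) / ε + Real.pi) := by
      gcongr
      exact norm_log_le_rpow hw hε
    _ = Real.exp (Real.pi * M) *
        (‖w‖ ^ (a.re + ε) / ε + ‖w‖ ^ (a.re - ε) / ε + Real.pi * ‖w‖ ^ a.re) := by
      rw [sub_eq_add_neg, Real.rpow_add hw0, Real.rpow_add hw0]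
      ring
    _ ≤ Real.exp (Real.pi * M) * ((y ^ b + y ^ B) / ε + (y ^ b + y ^ B) / ε +
        Real.pi * (y ^ b + y ^ B)) := by
      have := Real.pi_pos.le
      gcongr
      · exact key _ (by linarith) (by linarith)
      · exact key _ (by linarith) (by linarith)
      · exact key _ (by linarith) (by linarith)
    _ = _ := by ring

/-- The second periodic Bernoulli function. -/
noncomputable def periodicBernoulliTwo (t : ℝ) : ℝ := Int.fract t ^ 2 - Int.fract t + 1 / 6

lemma measurable_periodicBernoulliTwo : Measurable periodicBernoulliTwo := by
  unfold periodicBernoulliTwo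
  fun_prop

lemma abs_periodicBernoulliTwo_le_one (t : ℝ) : |periodicBernoulliTwo t| ≤ 1 := by
  have h0 := Int.fract_nonneg t
  have h1 := (Int.fract_lt_one t).le
  unfold periodicBernoulliTwo
  rw [abs_le]
  constructor <;> nlinarith

lemma aestronglyMeasurable_periodicBernoulliTwo_mul_cpow (z a : ℂ) (μ : Measure ℝ) :
    AEStronglyMeasurable (fun t : ℝ => (periodicBernoulliTwo t : ℂ) * (z + t) ^ a) μ := by
  have := measurable_periodicBernoulliTwo
  apply Measurable.aestronglyMeasurable
  fun_prop

lemma integrableOn_periodicBernoulliTwo_mul_cpow {z : ℂ} (hz : 0 < z.re) {a : ℂ}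
    (ha : a.re < -1) :
    IntegrableOn (fun t : ℝ => (periodicBernoulliTwo t : ℂ) * (z + t) ^ a) (Set.Ioi 0) := by
  refine Integrable.mono' ((integrableOn_add_rpow_Ioi_of_lt ha
    (by linarith : -z.re < 0)).mul_const (Real.exp (Real.pi * |a.im|)))
    (aestronglyMeasurable_periodicBernoulliTwo_mul_cpow z a _) ?_
  refine (ae_restrict_iff' measurableSet_Ioi).mpr (Filter.Eventually.of_forall fun t ht => ?_)
  rw [norm_mul, norm_real, Real.norm_eq_abs]
  exact (mul_le_of_le_one_left (norm_nonneg _) (abs_periodicBernoulliTwo_le_one t)).trans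
    (norm_add_ofReal_cpow_le hz (le_of_lt ht) (by linarith))

lemma differentiableAt_integral_periodicBernoulliTwo_mul_cpow {z : ℂ} (hz : 0 < z.re) {a₀ : ℂ}
    (ha : a₀.re < -1) :
    DifferentiableAt ℂ
      (fun a : ℂ => ∫ t in Set.Ioi (0 : ℝ), (periodicBernoulliTwo t : ℂ) * (z + t) ^ a) a₀ := by
  obtain ⟨ε, hε, hε'⟩ : ∃ ε : ℝ, 0 < ε ∧ a₀.re + 2 * ε < -1 :=
    ⟨(-1 - a₀.re) / 3, by linarith, by linarith⟩
  have hlog : AEStronglyMeasurable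
      (fun t : ℝ => (periodicBernoulliTwo t : ℂ) * ((z + t) ^ a₀ * log (z + t)))
      (volume.restrict (Set.Ioi 0)) := by
    have := measurable_periodicBernoulliTwo
    apply Measurable.aestronglyMeasurable
    fun_prop
  have hz' : -z.re < 0 := by linarith
  have hbound := ((integrableOn_add_rpow_Ioi_of_lt (by linarith : a₀.re - 2 * ε < -1) hz').add
    (integrableOn_add_rpow_Ioi_of_lt hε' hz')).const_mul
      ((2 / ε + Real.pi) * Real.exp (Real.pi * (|a₀.im| + ε)))
  refine (hasDerivAt_integral_of_dominated_loc_of_deriv_le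
    (F := fun (a : ℂ) (t : ℝ) => (periodicBernoulliTwo t : ℂ) * (z + t) ^ a)
    (F' := fun (a : ℂ) (t : ℝ) => (periodicBernoulliTwo t : ℂ) * ((z + t) ^ a * log (z + t)))
    (Metric.ball_mem_nhds a₀ hε)
    (Filter.Eventually.of_forall fun a => aestronglyMeasurable_periodicBernoulliTwo_mul_cpow z a _)
    (integrableOn_periodicBernoulliTwo_mul_cpow hz ha) hlog ?_ hbound ?_).2.differentiableAt
  · refine (ae_restrict_iff' measurableSet_Ioi).mpr (Filter.Eventually.of_forall fun t ht a h => ?_)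
    rw [Metric.mem_ball, dist_eq] at h
    have hre := abs_le.mp ((abs_re_le_norm (a - a₀)).trans h.le)
    have him := (abs_im_le_norm (a - a₀)).trans h.le
    rw [sub_re] at hre
    rw [sub_im] at him
    have him' : |a.im| ≤ |a₀.im| + ε := by
      have := abs_sub_abs_le_abs_sub a.im a₀.im
      linarith
    rw [norm_mul, norm_real, Real.norm_eq_abs]
    exact (mul_le_of_le_one_left (norm_nonneg _) (abs_periodicBernoulliTwo_le_one t)).trans
      (norm_cpow_mul_log_le hz (le_of_lt ht) hε (by linarith [hre.1]) (by linarith [hre.2])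
        (by linarith) him')
  · refine (ae_restrict_iff' measurableSet_Ioi).mpr (Filter.Eventually.of_forall fun t ht a _ => ?_)
    have hw := slitPlane_ne_zero (add_ofReal_mem_slitPlane hz (le_of_lt ht))
    simpa using ((hasDerivAt_id a).const_cpow (c := z + t) (Or.inl hw)).const_mul
      (periodicBernoulliTwo t : ℂ)

/-- The boundary terms of the Euler–Maclaurin formula for `w ^ (-s)`. -/
noncomputable def eulerMaclaurinBoundary (s w : ℂ) : ℂ :=
  w ^ (1 - s) / (s - 1) + w ^ (-s) / 2 + (s / 12) * w ^ (-s - 1)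

lemma hasDerivAt_eulerMaclaurin_primitive {w : ℂ} (hw : 0 < w.re) {s : ℂ} (hs : s ≠ 1) {t : ℝ}
    (ht : 0 ≤ t) :
    HasDerivAt (fun t : ℝ => -(s / 2) * ((t : ℂ) ^ 2 - t + 1 / 6) * (w + t) ^ (-s - 1) -
        ((t : ℂ) - 1 / 2) * (w + t) ^ (-s) - (w + t) ^ (1 - s) / (s - 1))
      (s * (s + 1) / 2 * (((t : ℂ) ^ 2 - t + 1 / 6) * (w + t) ^ (-(s + 2)))) t := by
  have hmem := add_ofReal_mem_slitPlane hw ht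
  have hid : HasDerivAt (fun t : ℝ => (t : ℂ)) 1 t := ofRealCLM.hasDerivAt
  have hpow : ∀ a : ℂ, HasDerivAt (fun t : ℝ => (w + t) ^ a) (a * (w + t) ^ (a - 1)) t := by
    intro a
    have h := ((hasDerivAt_id (t : ℂ)).const_add w).cpow_const (c := a) hmem
    simpa using h.comp_ofReal
  have h1 := (((hid.pow 2).sub hid).add_const (1 / 6)).const_mul (-(s / 2)) |>.mul (hpow (-s - 1))
  have h2 := (hid.sub_const (1 / 2)).mul (hpow (-s))
  have h3 := (hpow (1 - s)).div_const (s - 1)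
  refine ((h1.sub h2).sub h3).congr_deriv ?_
  have e1 : -s - 1 - 1 = -(s + 2) := by ring
  have e2 : 1 - s - 1 = -s := by ring
  have hs' : s - 1 ≠ 0 := sub_ne_zero.mpr hs
  simp only [e1, e2, Pi.sub_apply, Pi.pow_apply]
  field_simp
  push_cast
  ring

lemma intervalIntegrable_eulerMaclaurin {w : ℂ} (hw : 0 < w.re) (a : ℂ) :
    IntervalIntegrable (fun t : ℝ => (((t : ℂ) ^ 2 - t + 1 / 6) * (w + t) ^ a)) volume 0 1 := by
  refine ContinuousOn.intervalIntegrable fun t ht => ?_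
  rw [Set.uIcc_of_le zero_le_one] at ht
  have hmem := add_ofReal_mem_slitPlane hw ht.1
  have : ContinuousAt (fun t : ℝ => (w + t) ^ a) t := by
    refine ContinuousAt.cpow ?_ continuousAt_const hmem
    fun_prop
  exact ContinuousAt.continuousWithinAt (by fun_prop)

lemma mul_integral_bernoulli_mul_cpow {w : ℂ} (hw : 0 < w.re) {s : ℂ} (hs : s ≠ 1) :
    s * (s + 1) / 2 * ∫ t in (0 : ℝ)..1, ((t : ℂ) ^ 2 - t + 1 / 6) * (w + t) ^ (-(s + 2)) =
      eulerMaclaurinBoundary s w - eulerMaclaurinBoundary s (w + 1) - w ^ (-s) := by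
  rw [← intervalIntegral.integral_const_mul, intervalIntegral.integral_eq_sub_of_hasDerivAt
    (fun t ht => hasDerivAt_eulerMaclaurin_primitive hw hs
      (by rw [Set.uIcc_of_le zero_le_one] at ht; exact ht.1))
    ((intervalIntegrable_eulerMaclaurin hw _).const_mul _)]
  simp only [eulerMaclaurinBoundary, ofReal_zero, ofReal_one, add_zero]
  ring

lemma integral_periodicBernoulliTwo_mul_cpow_nat (z a : ℂ) (k : ℕ) :
    ∫ t in (k : ℝ)..(k + 1 : ℕ), (periodicBernoulliTwo t : ℂ) * (z + t) ^ a =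
      ∫ t in (0 : ℝ)..1, ((t : ℂ) ^ 2 - t + 1 / 6) * ((k + z) + t) ^ a := by
  have h := intervalIntegral.integral_comp_add_right (a := 0) (b := 1)
    (fun t : ℝ => (periodicBernoulliTwo t : ℂ) * (z + t) ^ a) (k : ℝ)
  rw [zero_add, add_comm 1 (k : ℝ)] at h
  push_cast
  rw [← h]
  refine intervalIntegral.integral_congr_Ioo_of_le zero_le_one fun t ht => ?_
  have hfract : Int.fract (t + k) = t := by
    rw [Int.fract_add_natCast, Int.fract_eq_self.mpr ⟨ht.1.le, ht.2⟩]
  simp only [periodicBernoulliTwo, hfract]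
  push_cast
  rw [show z + ((t : ℂ) + k) = k + z + t by ring]

lemma sum_cpow_eq_eulerMaclaurin {z : ℂ} (hz : 0 < z.re) {s : ℂ} (hs1 : s ≠ 1)
    (hs : -1 < s.re) (n : ℕ) :
    ∑ k ∈ Finset.range n, ((k : ℂ) + z) ^ (-s) =
      eulerMaclaurinBoundary s z - eulerMaclaurinBoundary s (n + z) - s * (s + 1) / 2 *
        ∫ t in (0 : ℝ)..n, (periodicBernoulliTwo t : ℂ) * (z + t) ^ (-(s + 2)) := by
  have hint : IntegrableOn (fun t : ℝ => (periodicBernoulliTwo t : ℂ) * (z + t) ^ (-(s + 2)))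
      (Set.Ioi 0) := integrableOn_periodicBernoulliTwo_mul_cpow hz (by simp; linarith)
  have hii : ∀ a b : ℕ, a ≤ b → IntervalIntegrable
      (fun t : ℝ => (periodicBernoulliTwo t : ℂ) * (z + t) ^ (-(s + 2))) volume a b := by
    intro a b hab
    rw [intervalIntegrable_iff_integrableOn_Ioc_of_le (by exact_mod_cast hab)]
    exact hint.mono_set fun t ht => lt_of_le_of_lt (Nat.cast_nonneg a) ht.1
  induction n with
  | zero => simp
  | succ n ih =>
    have h0 := hii 0 n n.zero_le
    rw [Nat.cast_zero] at h0
    rw [Finset.sum_range_succ, ih,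
      ← intervalIntegral.integral_add_adjacent_intervals h0 (hii n (n + 1) n.le_succ),
      integral_periodicBernoulliTwo_mul_cpow_nat]
    have hre : 0 < ((n : ℂ) + z).re := by
      simp only [add_re, natCast_re]
      positivity
    have hsucc : ((n + 1 : ℕ) : ℂ) + z = n + z + 1 := by push_cast; ring
    rw [hsucc]
    linear_combination mul_integral_bernoulli_mul_cpow hre hs1

lemma tendsto_natCast_add_cpow_zero {z : ℂ} (hz : 0 < z.re) {a : ℂ} (ha : a.re < 0) :
    Filter.Tendsto (fun n : ℕ => ((n : ℂ) + z) ^ a) Filter.atTop (nhds 0) := by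
  have h1 : Filter.Tendsto (fun n : ℕ => (n : ℝ) + z.re) Filter.atTop Filter.atTop :=
    Filter.tendsto_atTop_add_const_right _ _ tendsto_natCast_atTop_atTop
  have h2 := ((tendsto_rpow_neg_atTop (neg_pos.mpr ha)).comp h1).mul_const
    (Real.exp (Real.pi * |a.im|))
  rw [zero_mul] at h2
  refine squeeze_zero_norm (fun n => ?_) h2
  have := norm_add_ofReal_cpow_le hz (Nat.cast_nonneg n : (0 : ℝ) ≤ n) ha.le
  simpa [add_comm z] using this

lemma summable_natCast_add_cpow {z : ℂ} (hz : 0 < z.re) {s : ℂ} (hs : 1 < s.re) :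
    Summable fun n : ℕ => ((n : ℂ) + z) ^ (-s) := by
  refine Summable.of_norm_bounded (((Real.summable_one_div_nat_add_rpow z.re s.re).mpr hs).mul_right
    (Real.exp (Real.pi * |(-s).im|))) fun n => ?_
  have h0 : 0 < (n : ℝ) + z.re := by positivity
  have := norm_add_ofReal_cpow_le hz (Nat.cast_nonneg n : (0 : ℝ) ≤ n) (a := -s)
    (by rw [neg_re]; linarith)
  rw [neg_re, Real.rpow_neg h0.le, ← one_div, ofReal_natCast, add_comm z] at this
  rwa [abs_of_pos h0]

lemma tsum_cpow_eq_eulerMaclaurin {z : ℂ} (hz : 0 < z.re) {s : ℂ} (hs : 1 < s.re) :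
    ∑' k : ℕ, ((k : ℂ) + z) ^ (-s) = eulerMaclaurinBoundary s z - s * (s + 1) / 2 *
      ∫ t in Set.Ioi (0 : ℝ), (periodicBernoulliTwo t : ℂ) * (z + t) ^ (-(s + 2)) := by
  have hs1 : s ≠ 1 := by
    rintro rfl
    simp at hs
  have hb : Filter.Tendsto (fun n : ℕ => eulerMaclaurinBoundary s (n + z)) Filter.atTop
      (nhds 0) := by
    have h1 := tendsto_natCast_add_cpow_zero hz (a := 1 - s) (by simp; linarith)
    have h2 := tendsto_natCast_add_cpow_zero hz (a := -s) (by simp; linarith)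
    have h3 := tendsto_natCast_add_cpow_zero hz (a := -s - 1) (by simp; linarith)
    simpa [eulerMaclaurinBoundary] using
      ((h1.div_const (s - 1)).add (h2.div_const 2)).add (h3.const_mul (s / 12))
  have hi := intervalIntegral_tendsto_integral_Ioi 0
    (integrableOn_periodicBernoulliTwo_mul_cpow hz (a := -(s + 2)) (by simp; linarith))
    tendsto_natCast_atTop_atTop
  have hlim := (hb.const_sub (eulerMaclaurinBoundary s z)).sub (hi.const_mul (s * (s + 1) / 2))
  rw [sub_zero] at hlim
  refine tendsto_nhds_unique (summable_natCast_add_cpow hz hs).hasSum.tendsto_sum_nat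
    (hlim.congr fun n => ?_)
  exact (sum_cpow_eq_eulerMaclaurin hz hs1 (by linarith) n).symm

lemma isPreconnected_re_gt_neg_one_diff_one :
    IsPreconnected {s : ℂ | -1 < s.re ∧ s ≠ 1} := by
  have hre : Convex ℝ {s : ℂ | -1 < s.re} := convex_halfSpace_re_gt _
  have hA := (hre.inter (convex_halfSpace_im_gt 0)).isPreconnected
  have hB := (convex_halfSpace_re_gt 1).isPreconnected
  have hC := (hre.inter (convex_halfSpace_im_lt 0)).isPreconnected
  have hD := (hre.inter (convex_halfSpace_re_lt 1)).isPreconnected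
  have hAB := hA.union (2 + I) (by norm_num) (by norm_num) hB
  have hABC := hAB.union (2 - I) (by norm_num) (by norm_num) hC
  have hABCD := hABC.union I (by simp) (by simp) hD
  convert hABCD using 1
  ext s
  simp only [Set.mem_ofPred_eq, Set.mem_union, Set.mem_inter_iff, ne_eq, Complex.ext_iff, one_re,
    one_im]
  constructor
  · rintro ⟨h, hne⟩
    rcases lt_trichotomy s.im 0 with h1 | h1 | h1
    · tauto
    · rcases lt_trichotomy s.re 1 with h2 | h2 | h2 <;> tauto
    · tauto
  · rintro (((⟨h, hne⟩ | h) | ⟨h, hne⟩) | ⟨h, hne⟩)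
    · exact ⟨h, fun h2 => hne.ne' h2.2⟩
    · exact ⟨by linarith, fun h2 => h.ne' h2.1⟩
    · exact ⟨h, fun h2 => hne.ne h2.2⟩
    · exact ⟨h, fun h2 => hne.ne h2.1⟩

/-- the Euler–MacLaurin formula for the (analytically continued) Hurwitz
zeta function, valid for `Re z > 0` and all `s ≠ 1` with `Re s > -1`. -/
theorem hurwitzZeta_eulerMacLaurin (z : ℂ) (hz : 0 < z.re)
    (Z : ℂ → ℂ)
    (hZanal : DifferentiableOn ℂ Z {s : ℂ | s ≠ 1})
    (hZser : ∀ s : ℂ, 1 < s.re → Z s = ∑' k : ℕ, ((k : ℂ) + z) ^ (-s))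
    (s : ℂ) (hs1 : s ≠ 1) (hs : -1 < s.re) :
    Z s = z ^ (1 - s) / (s - 1) + z ^ (-s) / 2 + (s / 12) * z ^ (-s - 1) -
      (s * (s + 1) / 2) *
        ∫ t in Set.Ioi (0 : ℝ),
          ((Int.fract t ^ 2 - Int.fract t + 1 / 6 : ℝ) : ℂ) / (z + t) ^ (s + 2) := by
  have hz0 : z ≠ 0 := by
    rintro rfl
    simp at hz
  set U : Set ℂ := {s : ℂ | -1 < s.re ∧ s ≠ 1}
  have hU : IsOpen U := (isOpen_lt continuous_const continuous_re).inter isOpen_ne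
  have hF : DifferentiableOn ℂ (fun s : ℂ => eulerMaclaurinBoundary s z - s * (s + 1) / 2 *
      ∫ t in Set.Ioi (0 : ℝ), (periodicBernoulliTwo t : ℂ) * (z + t) ^ (-(s + 2))) U := by
    intro s hs
    have hI : DifferentiableAt ℂ (fun s : ℂ => ∫ t in Set.Ioi (0 : ℝ),
        (periodicBernoulliTwo t : ℂ) * (z + t) ^ (-(s + 2))) s :=
      DifferentiableAt.comp (f := fun s : ℂ => -(s + 2)) (g := fun a : ℂ =>
          ∫ t in Set.Ioi (0 : ℝ), (periodicBernoulliTwo t : ℂ) * (z + t) ^ a) s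
        (differentiableAt_integral_periodicBernoulliTwo_mul_cpow hz
          (by have := hs.1; simp; linarith))
        (by fun_prop)
    have hs' : s - 1 ≠ 0 := sub_ne_zero.mpr hs.2
    have hpow : ∀ f : ℂ → ℂ, DifferentiableAt ℂ f s → DifferentiableAt ℂ (fun s => z ^ f s) s :=
      fun f hf => hf.const_cpow (Or.inl hz0)
    have h1 := hpow (fun s => 1 - s) (by fun_prop)
    have h2 := hpow (fun s => -s) (by fun_prop)
    have h3 := hpow (fun s => -s - 1) (by fun_prop)
    unfold eulerMaclaurinBoundary
    exact DifferentiableAt.differentiableWithinAt (by fun_prop (disch := assumption))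
  have heq := ((hZanal.mono fun s hs => hs.2 : DifferentiableOn ℂ Z U).analyticOnNhd
    hU).eqOn_of_preconnected_of_eventuallyEq (hF.analyticOnNhd hU)
    isPreconnected_re_gt_neg_one_diff_one (z₀ := 2) (by norm_num [U])
    (by
      filter_upwards [(isOpen_lt continuous_const continuous_re).mem_nhds
        (by simp : (1 : ℝ) < (2 : ℂ).re)] with s hs
      rw [hZser s hs, tsum_cpow_eq_eulerMaclaurin hz hs]) ⟨hs, hs1⟩
  rw [heq]
  simp only [eulerMaclaurinBoundary, periodicBernoulliTwo, cpow_neg _ (s + 2), div_eq_mul_inv]
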